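/- arXiv:cs/0507038 — 5 statements merged into one kernel-verified Lean document; each statement's English description precedes it below -/
import Mathlib

section
/- Let A be an m×d real matrix all of whose entries are 0 or 1, and let b ∈ ℝ^m. Then the set of extreme points (vertices) of the polyhedron P = {x ∈ ℝ^d : A·x ≤ b (componentwise)} is finite and has cardinality at most d!. -/
open MeasureTheory Matrix

/-- The open corner simplex with vertices `0` and the standard basis vectors. -/
def openCornerSimplex (d : ℕ) : Set (Fin d → ℝ) :=
  {y | (∀ i, 0 < y i) ∧ ∑ i, y i < 1}

theorem isOpen_openCornerSimplex (d : ℕ) : IsOpen (openCornerSimplex d) := by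
  have h : openCornerSimplex d = (⋂ i, {y | 0 < y i}) ∩ {y | ∑ i, y i < 1} := by
    ext y; simp [openCornerSimplex]
  rw [h]
  exact (isOpen_iInter_of_finite fun i => isOpen_lt continuous_const (continuous_apply i)).inter
    (isOpen_lt (by fun_prop) continuous_const)

theorem volume_crossPolytope (d : ℕ) :
    volume {y : Fin d → ℝ | ∑ i, |y i| < 1} = ENNReal.ofReal (2 ^ d / d.factorial) := by
  rcases Nat.eq_zero_or_pos d with rfl | hd
  · simp [volume_pi]
  have : Nonempty (Fin d) := ⟨⟨0, hd⟩⟩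
  have h := volume_sum_rpow_lt (ι := Fin d) (p := 1) le_rfl 1
  simpa [one_add_one_eq_two, Real.Gamma_two, Real.Gamma_nat_eq_factorial] using h

/-- The cross-polytope is, up to a null set, the union of the `2 ^ d` sign changes of
the open corner simplex. -/
theorem inv_factorial_le_volume_openCornerSimplex (d : ℕ) :
    ENNReal.ofReal (1 / d.factorial) ≤ volume (openCornerSimplex d) := by
  let D (s : Fin d → ℤˣ) : (Fin d → ℝ) →ₗ[ℝ] (Fin d → ℝ) :=
    (Matrix.diagonal fun i => ((s i : ℤ) : ℝ)).toLin'
  have hD (s y i) : D s y i = (s i : ℤ) * y i := by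
    simp [D, Matrix.mulVec_diagonal]
  have hdet (s) : |LinearMap.det (D s)| = 1 := by
    simp only [D, LinearMap.det_toLin', Matrix.det_diagonal, Finset.abs_prod]
    refine Finset.prod_eq_one fun i _ => ?_
    rcases Int.units_eq_one_or (s i) with h | h <;> simp [h]
  have hvol (s) : volume (D s '' openCornerSimplex d) = volume (openCornerSimplex d) := by
    rw [Measure.addHaar_image_linearMap, hdet]; simp
  have hsub : {y : Fin d → ℝ | ∑ i, |y i| < 1} ⊆
      (⋃ s, D s '' openCornerSimplex d) ∪ ⋃ i, {y | y i = 0} := by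
    intro y hy
    by_cases h0 : ∃ i, y i = 0
    · exact Or.inr (by simpa using h0)
    push Not at h0
    refine Or.inl (Set.mem_iUnion.2 ⟨fun i => if 0 < y i then 1 else -1, fun i => |y i|,
      ⟨fun i => abs_pos.2 (h0 i), hy⟩, ?_⟩)
    ext i
    rw [hD]
    split_ifs with h
    · simp [abs_of_pos h]
    · simp [abs_of_nonpos (not_lt.1 h)]
  have hnull : volume (⋃ i, {y : Fin d → ℝ | y i = 0}) = 0 :=
    measure_iUnion_null fun i => by
      simpa [volume_pi] using Measure.pi_hyperplane (fun _ : Fin d => (volume : Measure ℝ)) i 0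
  have hle : ENNReal.ofReal (2 ^ d / d.factorial) ≤ 2 ^ d * volume (openCornerSimplex d) := by
    rw [← volume_crossPolytope]
    calc _ ≤ _ := measure_mono hsub
      _ ≤ _ := measure_union_le _ _
      _ ≤ _ := by
        rw [hnull, add_zero]
        refine (measure_iUnion_fintype_le _ _).trans ?_
        simp [hvol]
  have h2 : ENNReal.ofReal (2 ^ d / d.factorial) = 2 ^ d * ENNReal.ofReal (1 / d.factorial) := by
    rw [div_eq_mul_one_div, ENNReal.ofReal_mul (by positivity), ENNReal.ofReal_pow (by norm_num)]
    simp
  rw [h2] at hle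
  exact (ENNReal.mul_le_mul_iff_right (by simp) (by simp)).1 hle

theorem one_le_abs_det_of_zero_one {n : Type*} [Fintype n] [DecidableEq n] {M : Matrix n n ℝ}
    (hM : ∀ i j, M i j = 0 ∨ M i j = 1) (hdet : M.det ≠ 0) : 1 ≤ |M.det| := by
  have h (i j) : ∃ z : ℤ, (z : ℝ) = M i j := by
    rcases hM i j with h | h
    · exact ⟨0, by simp [h]⟩
    · exact ⟨1, by simp [h]⟩
  choose N hN using h
  have hcast : M.det = ((Matrix.of N).det : ℤ) := by
    rw [Int.cast_det]
    congr 1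
    ext i j
    simp [hN]
  rw [hcast] at hdet ⊢
  exact_mod_cast Int.one_le_abs (by exact_mod_cast hdet)

/-- The rows of the constraints that are tight at an extreme point span the whole space. -/
theorem span_tight_rows_eq_top {m n : Type*} [Finite m] [Fintype n]
    {A : Matrix m n ℝ} {b : m → ℝ} {v : n → ℝ}
    (hv : v ∈ Set.extremePoints ℝ {x | ∀ i, (A *ᵥ x) i ≤ b i}) :
    Submodule.span ℝ {a | ∃ i, a = A i ∧ (A *ᵥ v) i = b i} = ⊤ := by
  classical
  by_contra hne
  obtain ⟨f, hf0, hf⟩ := Submodule.exists_le_ker_of_lt_top _ (lt_top_iff_ne_top.2 hne)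
  set w : n → ℝ := fun j => f (Pi.single j 1)
  have hfw (x) : f x = x ⬝ᵥ w := by
    conv_lhs => rw [pi_eq_sum_univ' x]
    simp [w, dotProduct]
  have hw : w ≠ 0 := fun h => hf0 (LinearMap.ext fun x => by simp [hfw, h])
  have hev : ∀ᶠ t : ℝ in nhds 0, ∀ i, (A *ᵥ (v + t • w)) i ≤ b i := by
    refine Filter.eventually_all.2 fun i => ?_
    have hexp (t : ℝ) : (A *ᵥ (v + t • w)) i = (A *ᵥ v) i + t * (A i ⬝ᵥ w) := by
      simp [mulVec]
    simp only [hexp]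
    rcases (hv.1 i).eq_or_lt with h | h
    · have h0 : A i ⬝ᵥ w = 0 := by
        rw [← hfw]
        exact hf (Submodule.subset_span ⟨i, rfl, h⟩)
      simp [h0, h]
    · have hc : Continuous fun t : ℝ => (A *ᵥ v) i + t * (A i ⬝ᵥ w) := by fun_prop
      exact (hc.continuousAt.eventually_lt continuousAt_const (by simpa using h)).mono
        fun _ => le_of_lt
  obtain ⟨ε, hε, hball⟩ := Metric.eventually_nhds_iff.1 hev
  have hmem (t : ℝ) (ht : |t| < ε) := hball (y := t) (by simpa using ht)
  have h1 := hmem (ε / 2) (by rw [abs_of_pos] <;> linarith)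
  have h2 := hmem (-(ε / 2)) (by rw [abs_neg, abs_of_pos] <;> linarith)
  have heq := (mem_extremePoints.1 hv).2 _ h1 _ h2
    ⟨1 / 2, 1 / 2, by norm_num, by norm_num, by norm_num, by
      ext j; simp; ring⟩
  have : (ε / 2) • w = 0 := by simpa using heq.1
  exact hw ((smul_eq_zero.1 this).resolve_left (by positivity))

theorem exists_tight_submatrix_det_ne_zero {m n : Type*} [Finite m] [Fintype n] [DecidableEq n]
    {A : Matrix m n ℝ} {b : m → ℝ} {v : n → ℝ}
    (hv : v ∈ Set.extremePoints ℝ {x | ∀ i, (A *ᵥ x) i ≤ b i}) :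
    ∃ r : n → m, (A.submatrix r id).det ≠ 0 ∧ ∀ k, (A *ᵥ v) (r k) = b (r k) := by
  obtain ⟨s, hst, hspan, hli⟩ := exists_linearIndependent ℝ {a | ∃ i, a = A i ∧ (A *ᵥ v) i = b i}
  rw [span_tight_rows_eq_top hv] at hspan
  let B := Module.Basis.mk hli (by simp [hspan])
  let e := (Pi.basisFun ℝ n).indexEquiv B
  choose r hr using fun k => hst (e k).2
  refine ⟨r, ?_, fun k => (hr k).2⟩
  have hrow : (A.submatrix r id).row = fun k => ((e k : s) : n → ℝ) := by
    ext k j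
    rw [(hr k).1]; rfl
  have hli' : LinearIndependent ℝ (A.submatrix r id).row := by
    rw [hrow]
    exact hli.comp e e.injective
  exact ((isUnit_iff_isUnit_det _).1 (linearIndependent_rows_iff_isUnit.1 hli')).ne_zero

/-- A positive combination of linearly independent rows tight at `v` is a functional that,
over the polyhedron, attains its maximum only at `v`. -/
theorem dotProduct_vecMul_submatrix_lt {m n : Type*} [Fintype n] [DecidableEq n]
    {A : Matrix m n ℝ} {b : m → ℝ} {v w : n → ℝ} {r : n → m}
    (hr : (A.submatrix r id).det ≠ 0) (hv : ∀ k, (A *ᵥ v) (r k) = b (r k))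
    (hw : ∀ i, (A *ᵥ w) i ≤ b i) (hne : v ≠ w) {y : n → ℝ} (hy : ∀ k, 0 < y k) :
    (y ᵥ* A.submatrix r id) ⬝ᵥ w < (y ᵥ* A.submatrix r id) ⬝ᵥ v := by
  have hex : ∃ k, (A *ᵥ w) (r k) ≠ b (r k) := by
    by_contra! h
    refine hne (mulVec_injective_of_isUnit
      ((isUnit_iff_isUnit_det _).2 (isUnit_iff_ne_zero.2 hr)) ?_)
    ext k
    exact (hv k).trans (h k).symm
  obtain ⟨k, hk⟩ := hex
  rw [← dotProduct_mulVec, ← dotProduct_mulVec]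
  refine Finset.sum_lt_sum (fun l _ => ?_) ⟨k, Finset.mem_univ _, ?_⟩
  · exact mul_le_mul_of_nonneg_left ((hw (r l)).trans (hv l).ge) (hy l).le
  · exact mul_lt_mul_of_pos_left (((hw (r k)).lt_of_ne hk).trans_le (hv k).ge) (hy k)

theorem vecMul_mem_Icc_of_mem_openCornerSimplex {d : ℕ} {n : Type*} {M : Matrix (Fin d) n ℝ}
    (hM : ∀ i j, M i j = 0 ∨ M i j = 1) {y : Fin d → ℝ} (hy : y ∈ openCornerSimplex d) :
    y ᵥ* M ∈ Set.Icc (0 : n → ℝ) 1 := by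
  have hnonneg (k j) : 0 ≤ M k j := by rcases hM k j with h | h <;> simp [h]
  have hle (k j) : M k j ≤ 1 := by rcases hM k j with h | h <;> simp [h]
  constructor <;> intro j
  · exact Finset.sum_nonneg (s := Finset.univ) fun k _ => mul_nonneg (hy.1 k).le (hnonneg k j)
  · calc ∑ k, y k * M k j ≤ ∑ k, y k :=
          Finset.sum_le_sum fun k _ => mul_le_of_le_one_right (hy.1 k).le (hle k j)
      _ ≤ 1 := hy.2.le

theorem card_le_factorial_of_subset_extremePoints {m : Type*} [Finite m] {d : ℕ}
    {A : Matrix m (Fin d) ℝ} (hA : ∀ i j, A i j = 0 ∨ A i j = 1) {b : m → ℝ}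
    (F : Finset (Fin d → ℝ))
    (hF : (F : Set (Fin d → ℝ)) ⊆ Set.extremePoints ℝ {x | ∀ i, (A *ᵥ x) i ≤ b i}) :
    F.card ≤ d.factorial := by
  choose r hdet htight using
    fun v : F => exists_tight_submatrix_det_ne_zero (hF v.2)
  let L (v : F) : (Fin d → ℝ) →ₗ[ℝ] (Fin d → ℝ) := (A.submatrix (r v) id)ᵀ.toLin'
  have hL (v y) : L v y = y ᵥ* A.submatrix (r v) id := by
    simp only [L, toLin'_apply, mulVec_transpose]
  have hLdet (v) : LinearMap.det (L v) = (A.submatrix (r v) id).det := by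
    simp only [L, LinearMap.det_toLin', det_transpose]
  let S (v : F) : Set (Fin d → ℝ) := L v '' openCornerSimplex d
  have hmeas : ∀ v, MeasurableSet (S v) := by
    intro v
    have hsurj : Function.Surjective (L v) :=
      (LinearMap.equivOfDetNeZero (L v) (by rw [hLdet]; exact hdet v)).surjective
    exact ((L v).isOpenMap_of_finiteDimensional hsurj _ (isOpen_openCornerSimplex d)).measurableSet
  have hvol : ∀ v, ENNReal.ofReal (1 / d.factorial) ≤ volume (S v) := by
    intro v
    rw [Measure.addHaar_image_linearMap, hLdet]
    refine (inv_factorial_le_volume_openCornerSimplex d).trans (le_mul_of_one_le_left' ?_)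
    exact ENNReal.one_le_ofReal.2 (one_le_abs_det_of_zero_one (fun _ _ => hA _ _) (hdet v))
  have hdisj : Pairwise (Function.onFun Disjoint S) := by
    intro v w hne
    have hvw : (v : Fin d → ℝ) ≠ w := Subtype.coe_ne_coe.2 hne
    refine Set.disjoint_left.2 ?_
    rintro _ ⟨y, hy, rfl⟩ ⟨z, hz, hzy⟩
    have h1 := dotProduct_vecMul_submatrix_lt (hdet v) (htight v) (hF w.2).1 hvw hy.1
    have h2 := dotProduct_vecMul_submatrix_lt (hdet w) (htight w) (hF v.2).1 hvw.symm hz.1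
    rw [← hL] at h1 h2
    rw [hzy] at h2
    exact h1.not_gt h2
  have hsub : (⋃ v, S v) ⊆ Set.Icc 0 1 := by
    refine Set.iUnion_subset fun v => ?_
    rintro _ ⟨y, hy, rfl⟩
    rw [hL]
    exact vecMul_mem_Icc_of_mem_openCornerSimplex (fun _ _ => hA _ _) hy
  have hle : (F.card : ENNReal) * ENNReal.ofReal (1 / d.factorial) ≤ 1 := by
    calc _ = ∑ _v : F, ENNReal.ofReal (1 / d.factorial) := by simp
      _ ≤ ∑ v : F, volume (S v) := Finset.sum_le_sum fun v _ => hvol v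
      _ = volume (⋃ v, S v) := by rw [measure_iUnion hdisj hmeas, tsum_fintype]
      _ ≤ volume (Set.Icc (0 : Fin d → ℝ) 1) := measure_mono hsub
      _ = 1 := by simp [Real.volume_Icc_pi]
  rw [← ENNReal.ofReal_natCast, ← ENNReal.ofReal_mul (by positivity), ENNReal.ofReal_le_one,
    mul_one_div, div_le_one (by positivity)] at hle
  exact_mod_cast hle

/-- The polyhedron defined by a 0,1-constraint matrix `A` and a real vector `b`
has at most `d!` vertices (extreme points). -/
theorem zero_one_polyhedron_vertices_card_le (m d : ℕ)
    (A : Matrix (Fin m) (Fin d) ℝ)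
    (hA : ∀ i j, A i j = 0 ∨ A i j = 1)
    (b : Fin m → ℝ)
    (P : Set (Fin d → ℝ))
    (hP : P = {x : Fin d → ℝ | ∀ i, A.mulVec x i ≤ b i}) :
    (Set.extremePoints ℝ P).Finite ∧
      (Set.extremePoints ℝ P).ncard ≤ Nat.factorial d := by
  subst hP
  have hfin : (Set.extremePoints ℝ {x : Fin d → ℝ | ∀ i, A.mulVec x i ≤ b i}).Finite := by
    by_contra hinf
    obtain ⟨F, hF, hcard⟩ := Set.Infinite.exists_subset_card_eq hinf (d.factorial + 1)
    have := card_le_factorial_of_subset_extremePoints hA F hF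
    omega
  refine ⟨hfin, ?_⟩
  rw [Set.ncard_eq_toFinset_card _ hfin]
  exact card_le_factorial_of_subset_extremePoints hA (b := b) _ (by simp)
end

section
/- Let K be a positive integer, let A be an m×d matrix all of whose entries are integers lying in {−K, −K+1, …, −1, 0, 1, …, K}, and let b ∈ ℝ^m. Then the set of extreme points (vertices) of the polyhedron P = {x ∈ ℝ^d : A·x ≤ b (componentwise)} is finite and has cardinality at most (2K+1)^d · d!. -/
open MeasureTheory in
/-- The open corner simplex `{t | 0 < t, ∑ t < 1}` has volume at least `1 / n!`. -/
theorem one_le_factorial_mul_volume_cornerSimplex (ι : Type*) [Fintype ι] :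
    1 ≤ ((Fintype.card ι).factorial : ENNReal) *
      volume {t : ι → ℝ | (∀ i, 0 < t i) ∧ ∑ i, t i < 1} := by
  classical
  set n := Fintype.card ι with hn
  set S : Set (ι → ℝ) := {t | (∀ i, 0 < t i) ∧ ∑ i, t i < 1}
  let D : (ι → Bool) → (ι → ℝ) →ₗ[ℝ] (ι → ℝ) := fun σ =>
    Matrix.toLin' (Matrix.diagonal fun i => if σ i then (1 : ℝ) else -1)
  have hD : ∀ σ, volume (D σ '' S) = volume S := by
    intro σ
    have h : |∏ i, (if σ i then (1 : ℝ) else -1)| = 1 := by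
      rw [Finset.abs_prod]
      exact Finset.prod_eq_one fun i _ => by split_ifs <;> simp
    rw [Measure.addHaar_image_linearMap, LinearMap.det_toLin', Matrix.det_diagonal, h]
    simp
  have hcover : {x : ι → ℝ | ∑ i, |x i| ^ (1 : ℝ) < 1} ⊆
      (⋃ σ, D σ '' S) ∪ ⋃ i, {x : ι → ℝ | x i = 0} := by
    intro x hx
    by_cases h0 : ∃ i, x i = 0
    · exact Or.inr (Set.mem_iUnion.2 h0)
    · push Not at h0
      refine Or.inl (Set.mem_iUnion.2 ⟨fun i => decide (0 < x i), fun i => |x i|,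
        ⟨fun i => abs_pos.2 (h0 i), by simpa using hx⟩, ?_⟩)
      ext i
      simp only [D, Matrix.toLin'_apply, Matrix.mulVec_diagonal, decide_eq_true_eq]
      split_ifs with h
      · rw [abs_of_pos h, one_mul]
      · rw [abs_of_nonpos (not_lt.1 h)]; ring
  have hzero : volume (⋃ i, {x : ι → ℝ | x i = 0}) = 0 :=
    measure_iUnion_null fun i => Measure.pi_hyperplane _ i 0
  have hle : ENNReal.ofReal (2 ^ n / n.factorial) ≤ 2 ^ n * volume S := by
    calc ENNReal.ofReal (2 ^ n / n.factorial)
        = volume {x : ι → ℝ | ∑ i, |x i| ^ (1 : ℝ) < 1} := by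
          rw [volume_sum_rpow_lt_one ι le_rfl, ← hn]
          norm_num [Real.Gamma_nat_eq_factorial, Real.Gamma_two]
      _ ≤ _ := measure_mono hcover
      _ ≤ volume (⋃ σ, D σ '' S) + 0 := hzero ▸ measure_union_le _ _
      _ ≤ ∑ σ, volume (D σ '' S) := by
          rw [add_zero]
          exact measure_iUnion_fintype_le _ _
      _ = 2 ^ n * volume S := by simp [hD, hn]
  have hf : (0 : ℝ) < n.factorial := by positivity
  rw [ENNReal.ofReal_div_of_pos hf, ENNReal.ofReal_natCast,
    ENNReal.ofReal_pow zero_le_two, ENNReal.ofReal_ofNat] at hle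
  rw [ENNReal.div_le_iff (by simp [Nat.factorial_ne_zero]) (by simp), mul_assoc] at hle
  rw [← ENNReal.mul_le_mul_iff_right (a := 2 ^ n) (by simp) (by simp), mul_one]
  rwa [mul_comm (volume S)] at hle

/-- Every vertex of `{x | A x ≤ b}` is the unique solution of a square nonsingular subsystem of
tight constraints. -/
theorem exists_isUnit_tight_submatrix_of_mem_extremePoints {m d : ℕ}
    (A : Matrix (Fin m) (Fin d) ℝ) (b : Fin m → ℝ) {v : Fin d → ℝ}
    (hv : v ∈ Set.extremePoints ℝ {x : Fin d → ℝ | ∀ i, A.mulVec x i ≤ b i}) :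
    ∃ f : Fin d → Fin m, (∀ k, A.mulVec v (f k) = b (f k)) ∧ IsUnit (A.submatrix f id) := by
  rw [mem_extremePoints] at hv
  obtain ⟨hvP, hext⟩ := hv
  have hzero : ∀ y : Fin d → ℝ, (∀ i, A.mulVec v i = b i → A.mulVec y i = 0) → y = 0 := by
    intro y hy
    have hev : ∀ᶠ ε : ℝ in nhds 0, ∀ i, A.mulVec (v + ε • y) i ≤ b i := by
      rw [Filter.eventually_all]
      intro i
      simp only [Matrix.mulVec_add, Matrix.mulVec_smul, Pi.add_apply, Pi.smul_apply, smul_eq_mul]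
      rcases (hvP i).eq_or_lt with h | h
      · simp [hy i h, h]
      · have hc : Continuous fun ε : ℝ => A.mulVec v i + ε * A.mulVec y i := by fun_prop
        have := hc.tendsto 0
        simp only [zero_mul, add_zero] at this
        exact (this.eventually_lt_const h).mono fun _ => le_of_lt
    obtain ⟨r, hr, hball⟩ := Metric.eventually_nhds_iff.1 hev
    have h₁ := @hball (r / 2) (by simp [abs_of_pos hr, hr])
    have h₂ := @hball (-(r / 2)) (by simp [abs_of_pos hr, hr])
    have hseg : v ∈ openSegment ℝ (v + (r / 2) • y) (v + (-(r / 2)) • y) :=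
      ⟨1 / 2, 1 / 2, by norm_num, by norm_num, by norm_num, by module⟩
    have := (hext _ h₁ _ h₂ hseg).1
    simpa [hr.ne'] using this
  set s : Set (Fin d → ℝ) := A '' {i | A.mulVec v i = b i}
  have hspan : Submodule.span ℝ s = ⊤ := by
    by_contra hne
    obtain ⟨g, hg, hker⟩ := Submodule.exists_le_ker_of_lt_top _ (lt_top_iff_ne_top.2 hne)
    have hgx : ∀ x, g x = ∑ j, x j * g (Pi.single j 1) := by
      intro x
      conv_lhs => rw [pi_eq_sum_univ' x]
      simp
    have h0 := hzero (fun j => g (Pi.single j 1)) fun i hi => by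
      have : g (A i) = 0 := hker (Submodule.subset_span ⟨i, hi, rfl⟩)
      rw [hgx] at this
      exact this
    refine hg (LinearMap.ext fun x => ?_)
    rw [hgx]
    simp [fun j => congrFun h0 j]
  obtain ⟨a, has, -, hli⟩ := Submodule.exists_fun_fin_finrank_span_eq ℝ s
  have hrank : Module.finrank ℝ (Submodule.span ℝ s) = d := by rw [hspan]; simp
  choose f hf hfa using has
  refine ⟨fun k => f (Fin.cast hrank.symm k), fun k => hf _, ?_⟩
  rw [← Matrix.linearIndependent_rows_iff_isUnit]
  have hrow : (A.submatrix (fun k => f (Fin.cast hrank.symm k)) id).row =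
      a ∘ Fin.cast hrank.symm := funext fun k => hfa _
  rw [hrow]
  exact hli.comp _ (Fin.cast_injective hrank.symm)

/-- A nonsingular real matrix with integer entries has determinant of absolute value at least
one. -/
theorem one_le_abs_det_of_isUnit_of_int_entries {n : Type*} [Fintype n] [DecidableEq n]
    {M : Matrix n n ℝ} (hM : IsUnit M) (hint : ∀ i j, ∃ z : ℤ, M i j = z) : 1 ≤ |M.det| := by
  choose z hz using hint
  have h : M.det = ((Matrix.of z).det : ℤ) := by
    rw [Int.cast_det]
    congr 1
    ext i j
    exact hz i j
  have h0 : M.det ≠ 0 := ((Matrix.isUnit_iff_isUnit_det M).1 hM).ne_zero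
  rw [h] at h0 ⊢
  exact_mod_cast Int.one_le_abs (by exact_mod_cast h0)

/-- If `c` is a positive combination of a nonsingular system of constraints tight at `v`, then
`v` is the only maximizer of `c` on `{x | A x ≤ b}`. -/
theorem eq_of_dotProduct_vecMul_ge {m d : ℕ} {A : Matrix (Fin m) (Fin d) ℝ} {b : Fin m → ℝ}
    {f : Fin d → Fin m} {v w t : Fin d → ℝ} (hf : IsUnit (A.submatrix f id))
    (hv : ∀ k, A.mulVec v (f k) = b (f k)) (hw : ∀ i, A.mulVec w i ≤ b i) (ht : ∀ k, 0 < t k)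
    (h : Matrix.vecMul t (A.submatrix f id) ⬝ᵥ v ≤ Matrix.vecMul t (A.submatrix f id) ⬝ᵥ w) :
    w = v := by
  rw [← Matrix.dotProduct_mulVec, ← Matrix.dotProduct_mulVec] at h
  have hle : ∀ k ∈ Finset.univ, t k * (A.submatrix f id).mulVec w k ≤
      t k * (A.submatrix f id).mulVec v k := fun k _ =>
    mul_le_mul_of_nonneg_left ((hw (f k)).trans_eq (hv k).symm) (ht k).le
  have heq := (Finset.sum_eq_sum_iff_of_le hle).1 (le_antisymm (Finset.sum_le_sum hle) h)
  refine Matrix.mulVec_injective_iff_isUnit.2 hf (funext fun k => ?_)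
  exact mul_left_cancel₀ (ht k).ne' (heq k (Finset.mem_univ k))

open MeasureTheory in
/-- The polyhedron defined by a constraint matrix `A` with integer entries in
`{-K, …, K}` and a real vector `b` has at most `(2K+1)^d · d!` vertices. -/
theorem bounded_integer_polyhedron_vertices_card_le (K : ℕ) (hK : 0 < K)
    (m d : ℕ)
    (A : Matrix (Fin m) (Fin d) ℝ)
    (hA : ∀ i j, ∃ z : ℤ, A i j = (z : ℝ) ∧ |z| ≤ (K : ℤ))
    (b : Fin m → ℝ)
    (P : Set (Fin d → ℝ))
    (hP : P = {x : Fin d → ℝ | ∀ i, A.mulVec x i ≤ b i}) :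
    (Set.extremePoints ℝ P).Finite ∧
      (Set.extremePoints ℝ P).ncard ≤ (2 * K + 1) ^ d * Nat.factorial d := by
  subst hP
  set P : Set (Fin d → ℝ) := {x | ∀ i, A.mulVec x i ≤ b i}
  choose F hF hFu using fun v : Set.extremePoints ℝ P =>
    exists_isUnit_tight_submatrix_of_mem_extremePoints A b v.2
  have hFinj : Function.Injective F := by
    intro v w h
    refine Subtype.ext (Matrix.mulVec_injective_iff_isUnit.2 (hFu v) (funext fun k => ?_))
    exact (hF v k).trans ((congrArg (fun f => b (f k)) h).trans
      ((hF w k).symm.trans (congrArg (fun f => A.mulVec w (f k)) h.symm)))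
  have : Finite (Set.extremePoints ℝ P) := Finite.of_injective F hFinj
  refine ⟨Set.toFinite _, ?_⟩
  have := Fintype.ofFinite (Set.extremePoints ℝ P)
  rw [← Nat.card_coe_set_eq, Nat.card_eq_fintype_card]
  set S : Set (Fin d → ℝ) := {t | (∀ i, 0 < t i) ∧ ∑ i, t i < 1}
  have hS : MeasurableSet S := by
    simp only [S, Set.ofPred_and, Set.ofPred_forall]
    exact (MeasurableSet.iInter fun i => measurableSet_lt measurable_const
      (measurable_pi_apply i)).inter (measurableSet_lt (by fun_prop) measurable_const)
  let L : Set.extremePoints ℝ P → (Fin d → ℝ) →ₗ[ℝ] (Fin d → ℝ) := fun v =>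
    Matrix.toLin' (A.submatrix (F v) id).transpose
  have hL : ∀ v t, L v t = Matrix.vecMul t (A.submatrix (F v) id) := fun v t => by
    rw [Matrix.toLin'_apply, Matrix.mulVec_transpose]
  have hmeas : ∀ v, MeasurableSet (L v '' S) := fun v =>
    hS.image_of_continuousOn_injOn (L v).continuous_of_finiteDimensional.continuousOn
      (fun x _ y _ hxy => Matrix.vecMul_injective_of_isUnit (hFu v) (by simpa only [hL] using hxy))
  have hdisj : Pairwise (Function.onFun Disjoint fun v => L v '' S) := by
    intro v w hvw
    refine Set.disjoint_left.2 ?_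
    rintro _ ⟨t, ht, rfl⟩ ⟨u, hu, h⟩
    rw [hL, hL] at h
    rcases le_total (Matrix.vecMul t (A.submatrix (F v) id) ⬝ᵥ v.1)
      (Matrix.vecMul t (A.submatrix (F v) id) ⬝ᵥ w.1) with hle | hle
    · exact hvw (Subtype.ext
        (eq_of_dotProduct_vecMul_ge (hFu v) (hF v) w.2.1 ht.1 hle).symm)
    · rw [← h] at hle
      exact hvw (Subtype.ext (eq_of_dotProduct_vecMul_ge (hFu w) (hF w) v.2.1 hu.1 hle))
  have hvol : ∀ v, volume S ≤ volume (L v '' S) := by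
    intro v
    rw [Measure.addHaar_image_linearMap, LinearMap.det_toLin', Matrix.det_transpose]
    refine le_mul_of_one_le_left' (ENNReal.one_le_ofReal.2 ?_)
    exact one_le_abs_det_of_isUnit_of_int_entries (hFu v)
      fun i j => (hA (F v i) j).imp fun _ h => h.1
  have hbox : (⋃ v, L v '' S) ⊆ Set.Icc (fun _ => -(K : ℝ)) fun _ => K := by
    refine Set.iUnion_subset fun v => ?_
    rintro _ ⟨t, ⟨ht, hsum⟩, rfl⟩
    have hbound : ∀ j, |L v t j| ≤ K := by
      intro j
      have hentry : ∀ i, |A i j| ≤ K := fun i => by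
        obtain ⟨z, hz, hzK⟩ := hA i j
        rw [hz]
        exact_mod_cast hzK
      calc |L v t j| = |∑ i, t i * A (F v i) j| := by rw [hL]; rfl
        _ ≤ ∑ i, |t i * A (F v i) j| := Finset.abs_sum_le_sum_abs _ _
        _ ≤ ∑ i, t i * K := Finset.sum_le_sum fun i _ => by
          rw [abs_mul, abs_of_pos (ht i)]
          exact mul_le_mul_of_nonneg_left (hentry _) (ht i).le
        _ ≤ K := by
          rw [← Finset.sum_mul]
          exact mul_le_of_le_one_left (Nat.cast_nonneg K) hsum.le
    exact ⟨fun j => (abs_le.1 (hbound j)).1, fun j => (abs_le.1 (hbound j)).2⟩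
  have htotal : (Fintype.card (Set.extremePoints ℝ P) : ENNReal) * volume S ≤ (2 * K) ^ d :=
    calc (Fintype.card (Set.extremePoints ℝ P) : ENNReal) * volume S
        = ∑ _v : Set.extremePoints ℝ P, volume S := by simp
      _ ≤ ∑ v, volume (L v '' S) := Finset.sum_le_sum fun v _ => hvol v
      _ = volume (⋃ v, L v '' S) := by rw [measure_iUnion hdisj hmeas, tsum_fintype]
      _ ≤ _ := measure_mono hbox
      _ = (2 * K) ^ d := by
        rw [Real.volume_Icc_pi]
        have : (K : ℝ) - -K = ((2 * K : ℕ) : ℝ) := by push_cast; ring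
        simp only [this, ENNReal.ofReal_natCast]
        simp
  have hcard : (Fintype.card (Set.extremePoints ℝ P) : ENNReal) ≤
      ((2 * K) ^ d * d.factorial : ℕ) := by
    have hone := one_le_factorial_mul_volume_cornerSimplex (Fin d)
    rw [Fintype.card_fin] at hone
    calc (Fintype.card (Set.extremePoints ℝ P) : ENNReal)
        ≤ Fintype.card (Set.extremePoints ℝ P) * (d.factorial * volume S) :=
          le_mul_of_one_le_right' hone
      _ = Fintype.card (Set.extremePoints ℝ P) * volume S * d.factorial := by ring
      _ ≤ (2 * K) ^ d * d.factorial := by gcongr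
      _ = _ := by push_cast; rfl
  calc Fintype.card (Set.extremePoints ℝ P) ≤ (2 * K) ^ d * d.factorial := by exact_mod_cast hcard
    _ ≤ (2 * K + 1) ^ d * d.factorial := by gcongr; omega
end

section
/- Let Q ⊆ ℝ^d be a compact convex polytope (the convex hull of a finite set) containing the origin 0 in its interior. Let F₁ and F₂ be two distinct facets of Q, say F₁ = conv{p₁,…,p_r} and F₂ = conv{q₁,…,q_s}, where p₁,…,p_r and q₁,…,q_s are the vertices (extreme points) of Q lying on F₁ and F₂ respectively. Let λ₁,…,λ_r and μ₁,…,μ_s be positive real numbers. Then the interior of conv{0, λ₁p₁, …, λ_r p_r} and the interior of conv{0, μ₁q₁, …, μ_s q_s} are disjoint. -/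
open Topology in
/-- If `0` is an interior point of a set on which `⟨c, ·⟩ ≤ γ` with `c ≠ 0`, then `γ > 0`. -/
theorem pos_of_forall_dotProduct_le {ι : Type*} [Fintype ι] {Q : Set (ι → ℝ)} {c : ι → ℝ} {γ : ℝ}
    (h0 : (0 : ι → ℝ) ∈ interior Q) (hc : c ≠ 0) (h : ∀ x ∈ Q, c ⬝ᵥ x ≤ γ) : 0 < γ := by
  have hcont : Filter.Tendsto (fun t : ℝ => t • c) (𝓝 0) (𝓝 0) := by
    have : Continuous fun t : ℝ => t • c := by fun_prop
    simpa using this.tendsto 0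
  have hev : ∀ᶠ t : ℝ in 𝓝[>] 0, t • c ∈ Q :=
    (hcont.eventually (mem_interior_iff_mem_nhds.mp h0)).filter_mono nhdsWithin_le_nhds
  obtain ⟨t, htQ, ht⟩ := (hev.and self_mem_nhdsWithin).exists
  have hcc : 0 < c ⬝ᵥ c := by
    refine lt_of_le_of_ne (Finset.sum_nonneg fun i _ => mul_self_nonneg (c i)) fun h => hc ?_
    exact dotProduct_self_eq_zero.mp h.symm
  have := h _ htQ
  rw [dotProduct_smul, smul_eq_mul] at this
  exact (mul_pos ht hcc).trans_le this

/-- A linear functional that is nonpositive at each `v i` is nonpositive on the convex hull of `0`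
and nonnegative multiples of the `v i`. -/
theorem LinearMap.nonpos_of_mem_convexHull_insert_zero_range_smul {ι E : Type*} [AddCommGroup E]
    [Module ℝ E] (L : E →ₗ[ℝ] ℝ) {v : ι → E} {w : ι → ℝ} (hw : ∀ i, 0 ≤ w i)
    (hL : ∀ i, L (v i) ≤ 0) {x : E}
    (hx : x ∈ convexHull ℝ (insert 0 (Set.range fun i => w i • v i))) : L x ≤ 0 := by
  refine convexHull_min ?_ (convex_halfSpace_le L.isLinear 0) hx
  rintro _ (rfl | ⟨i, rfl⟩)
  · simp
  · simpa using mul_nonpos_of_nonneg_of_nonpos (hw i) (hL i)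

/-- Let `Q` be a compact convex polytope in `ℝ^d` containing `0` in its interior, and let
`F₁ = conv{p₁,…,p_r}` and `F₂ = conv{q₁,…,q_s}` be two distinct facets of `Q`, where the
`pᵢ` (resp. `qⱼ`) are the vertices of `Q` lying on `F₁` (resp. `F₂`). For any positive
reals `λᵢ`, `μⱼ`, the interiors of `conv{0, λ₁p₁,…,λ_r p_r}` and
`conv{0, μ₁q₁,…,μ_s q_s}` are disjoint. -/
theorem interior_stretched_facet_pyramids_disjoint (d r s : ℕ)
    (V : Finset (Fin d → ℝ)) (Q : Set (Fin d → ℝ))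
    (hQ : Q = convexHull ℝ (V : Set (Fin d → ℝ)))
    (h0 : (0 : Fin d → ℝ) ∈ interior Q)
    (c₁ c₂ : Fin d → ℝ) (γ₁ γ₂ : ℝ) (hc₁ : c₁ ≠ 0) (hc₂ : c₂ ≠ 0)
    (F₁ F₂ : Set (Fin d → ℝ))
    (hF₁ : F₁ = {x ∈ Q | ∑ i, c₁ i * x i = γ₁})
    (hF₂ : F₂ = {x ∈ Q | ∑ i, c₂ i * x i = γ₂})
    (hvalid₁ : ∀ x ∈ Q, ∑ i, c₁ i * x i ≤ γ₁)
    (hvalid₂ : ∀ x ∈ Q, ∑ i, c₂ i * x i ≤ γ₂)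
    (hdim₁ : Module.finrank ℝ (affineSpan ℝ F₁).direction = d - 1)
    (hdim₂ : Module.finrank ℝ (affineSpan ℝ F₂).direction = d - 1)
    (hne : F₁ ≠ F₂)
    (p : Fin r → (Fin d → ℝ)) (q : Fin s → (Fin d → ℝ))
    (hp : Set.range p = Set.extremePoints ℝ Q ∩ F₁)
    (hq : Set.range q = Set.extremePoints ℝ Q ∩ F₂)
    (hF₁conv : F₁ = convexHull ℝ (Set.range p))
    (hF₂conv : F₂ = convexHull ℝ (Set.range q))
    (lam : Fin r → ℝ) (mu : Fin s → ℝ)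
    (hlam : ∀ i, 0 < lam i) (hmu : ∀ j, 0 < mu j) :
    interior (convexHull ℝ (insert 0 (Set.range fun i => lam i • p i))) ∩
      interior (convexHull ℝ (insert 0 (Set.range fun j => mu j • q j))) = ∅ := by
  by_contra hnonempty
  have hγ₁ : 0 < γ₁ := pos_of_forall_dotProduct_le h0 hc₁ hvalid₁
  have hγ₂ : 0 < γ₂ := pos_of_forall_dotProduct_le h0 hc₂ hvalid₂
  have hp' : ∀ i, p i ∈ F₁ := fun i => (hp.subset ⟨i, rfl⟩).2
  have hq' : ∀ j, q j ∈ F₂ := fun j => (hq.subset ⟨j, rfl⟩).2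
  subst hF₁ hF₂
  let L : (Fin d → ℝ) →ₗ[ℝ] ℝ := dotProductBilin ℝ ℝ (γ₁ • c₂ - γ₂ • c₁)
  have hL : ∀ x, L x = γ₁ * ∑ i, c₂ i * x i - γ₂ * ∑ i, c₁ i * x i := fun x => by
    change (γ₁ • c₂ - γ₂ • c₁) ⬝ᵥ x = _
    rw [sub_dotProduct, smul_dotProduct, smul_dotProduct]
    rfl
  have hLp : ∀ i, L (p i) ≤ 0 := fun i => by
    rw [hL, (hp' i).2]
    nlinarith [hvalid₂ _ (hp' i).1]
  have hLq : ∀ j, (-L) (q j) ≤ 0 := fun j => by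
    rw [LinearMap.neg_apply, hL, (hq' j).2]
    nlinarith [hvalid₁ _ (hq' j).1]
  have hker : L.ker = ⊤ := by
    refine Submodule.eq_top_of_nonempty_interior' _ ?_
    refine (Set.nonempty_iff_ne_empty.mpr hnonempty).mono ?_
    refine interior_maximal (fun x hx => ?_) (isOpen_interior.inter isOpen_interior)
    have h₁ := L.nonpos_of_mem_convexHull_insert_zero_range_smul (fun i => (hlam i).le) hLp
      (interior_subset hx.1)
    have h₂ := (-L).nonpos_of_mem_convexHull_insert_zero_range_smul (fun j => (hmu j).le) hLq
      (interior_subset hx.2)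
    rw [LinearMap.neg_apply] at h₂
    exact le_antisymm h₁ (by linarith)
  refine hne (Set.ext fun x => and_congr_right fun _ => ?_)
  have hx : L x = 0 := LinearMap.mem_ker.mp (hker ▸ Submodule.mem_top)
  rw [hL] at hx
  constructor <;> intro h <;> rw [h] at hx
  · exact mul_left_cancel₀ hγ₁.ne' (by linarith)
  · exact mul_left_cancel₀ hγ₂.ne' (by linarith)
end

section
/- Let d ≥ 1 and let P ⊆ ℝ^d be the Minkowski sum of the permutahedron Π_{d−1} = conv{(σ(1), σ(2), …, σ(d)) : σ a permutation of {1,…,d}} and the nonpositive orthant (−∞,0]^d. Then the set of extreme points (vertices) of P is exactly the set {(σ(1), …, σ(d)) : σ a permutation of {1,…,d}}; in particular P has exactly d! vertices. -/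
open Pointwise

/-- An extreme point of `conv s + C` lies in `s`, if `C` contains `0` and is closed under doubling. -/
theorem extremePoints_convexHull_add_subset {E : Type*} [AddCommGroup E] [Module ℝ E]
    {s C : Set E} (h0 : (0 : E) ∈ C) (h2 : ∀ b ∈ C, b + b ∈ C) :
    Set.extremePoints ℝ (convexHull ℝ s + C) ⊆ s := by
  intro x hx
  obtain ⟨a, ha, b, hb, rfl⟩ := Set.mem_add.mp hx.1
  have hsub : convexHull ℝ s ⊆ convexHull ℝ s + C := Set.subset_add_left _ h0
  have hab : a = a + b := by
    refine hx.2 (hsub ha) (Set.add_mem_add ha (h2 b hb)) ?_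
    exact ⟨1 / 2, 1 / 2, by norm_num, by norm_num, by norm_num, by module⟩
  rw [← hab] at hx ⊢
  exact extremePoints_convexHull_subset
    (inter_extremePoints_subset_extremePoints_of_subset hsub ⟨ha, hx⟩)

/-- The strict lower half-space of a linear functional at `v`, together with `v`, is convex. -/
theorem convex_eq_or_lt {E : Type*} [AddCommGroup E] [Module ℝ E] (l : E →ₗ[ℝ] ℝ) (v : E) :
    Convex ℝ {y | y = v ∨ l y < l v} := by
  refine convex_iff_forall_pos.mpr fun x hx y hy a b ha hb hab => ?_
  have hle {z : E} (hz : z = v ∨ l z < l v) : l z ≤ l v := hz.elim (fun h => h ▸ le_rfl) le_of_lt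
  have hv : l v = a * l v + b * l v := by rw [← add_mul, hab, one_mul]
  simp only [Set.mem_ofPred_eq, map_add, map_smul, smul_eq_mul]
  rcases hx with rfl | hx
  · rcases hy with rfl | hy
    · exact Or.inl (Convex.combo_self hab _)
    · right
      nlinarith [mul_lt_mul_of_pos_left hy hb]
  · right
    nlinarith [mul_lt_mul_of_pos_left hx ha, mul_le_mul_of_nonneg_left (hle hy) hb.le]

/-- A positive vector of maximal Euclidean norm in `s` is an extreme point of the sum of
`conv s` and the nonpositive orthant. -/
theorem mem_extremePoints_convexHull_add_nonpos {ι : Type*} [Fintype ι] {s : Set (ι → ℝ)}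
    {v : ι → ℝ} (hv : v ∈ s) (hpos : ∀ i, 0 < v i)
    (hs : ∀ u ∈ s, ∑ i, u i ^ 2 ≤ ∑ i, v i ^ 2) :
    v ∈ Set.extremePoints ℝ (convexHull ℝ s + {x : ι → ℝ | ∀ i, x i ≤ 0}) := by
  let l : (ι → ℝ) →ₗ[ℝ] ℝ := ∑ i, v i • LinearMap.proj i
  have hl (y : ι → ℝ) : l y = ∑ i, v i * y i := by simp [l]
  have hhull : convexHull ℝ s ⊆ {y | y = v ∨ l y < l v} := by
    refine convexHull_min (fun u hu => or_iff_not_imp_left.mpr fun hne => ?_) (convex_eq_or_lt l v)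
    obtain ⟨j, hj⟩ := Function.ne_iff.mp hne
    have hdist : 0 < ∑ i, (u i - v i) ^ 2 :=
      Finset.sum_pos' (fun i _ => sq_nonneg _)
        ⟨j, Finset.mem_univ j, sq_pos_of_ne_zero (sub_ne_zero.mpr hj)⟩
    have hexp : ∑ i, (u i - v i) ^ 2 = ∑ i, u i ^ 2 + ∑ i, v i ^ 2 - 2 * l u := by
      rw [hl, Finset.mul_sum, ← Finset.sum_add_distrib, ← Finset.sum_sub_distrib]
      exact Finset.sum_congr rfl fun i _ => by ring
    have hvv : l v = ∑ i, v i ^ 2 := by simp only [hl, sq]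
    linarith [hs u hu]
  have hP : ∀ y ∈ convexHull ℝ s + {x : ι → ℝ | ∀ i, x i ≤ 0}, y = v ∨ l y < l v := by
    rintro _ ⟨a, ha, b, hb, rfl⟩
    by_cases hb0 : b = 0
    · simpa [hb0] using hhull ha
    · right
      obtain ⟨j, hj⟩ := Function.ne_iff.mp hb0
      have hlb : l b < 0 := by
        rw [hl]
        exact Finset.sum_neg' (fun i _ => mul_nonpos_of_nonneg_of_nonpos (hpos i).le (hb i))
          ⟨j, Finset.mem_univ j, mul_neg_of_pos_of_neg (hpos j) (lt_of_le_of_ne (hb j) hj)⟩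
      have hla : l a ≤ l v := (hhull ha).elim (fun h => h ▸ le_rfl) le_of_lt
      simp only [map_add]
      linarith
  refine exposedPoints_subset_extremePoints (𝕜 := ℝ)
    ⟨⟨v, subset_convexHull ℝ s hv, 0, fun _ => le_rfl, add_zero v⟩,
      LinearMap.toContinuousLinearMap l, fun y hy => ?_⟩
  rcases hP y hy with rfl | hlt
  · exact ⟨le_rfl, fun _ => rfl⟩
  · exact ⟨hlt.le, fun h => absurd h (not_le.mpr hlt)⟩

/-- The vertices of the Minkowski sum of the permutahedron `Π_{d-1}` and the
nonpositive orthant are exactly the `d!` permutations of `(1, 2, …, d)`. -/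
theorem extremePoints_permutahedron_plus_nonpositive_orthant (d : ℕ) (hd : 1 ≤ d)
    (P : Set (Fin d → ℝ))
    (hP : P =
      convexHull ℝ {x : Fin d → ℝ | ∃ σ : Equiv.Perm (Fin d),
          x = fun i => ((σ i : ℕ) : ℝ) + 1}
        + {x : Fin d → ℝ | ∀ i, x i ≤ 0}) :
    Set.extremePoints ℝ P =
      {x : Fin d → ℝ | ∃ σ : Equiv.Perm (Fin d), x = fun i => ((σ i : ℕ) : ℝ) + 1} ∧
    (Set.extremePoints ℝ P).ncard = Nat.factorial d := by
  subst hP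
  have hext : Set.extremePoints ℝ (convexHull ℝ {x : Fin d → ℝ | ∃ σ : Equiv.Perm (Fin d),
          x = fun i => ((σ i : ℕ) : ℝ) + 1} + {x : Fin d → ℝ | ∀ i, x i ≤ 0}) =
      {x : Fin d → ℝ | ∃ σ : Equiv.Perm (Fin d), x = fun i => ((σ i : ℕ) : ℝ) + 1} := by
    refine Set.Subset.antisymm (extremePoints_convexHull_add_subset (fun _ => le_rfl)
      fun b hb i => add_nonpos (hb i) (hb i)) ?_
    rintro _ ⟨σ, rfl⟩
    refine mem_extremePoints_convexHull_add_nonpos ⟨σ, rfl⟩ (fun i => by positivity) ?_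
    rintro _ ⟨τ, rfl⟩
    exact ((Equiv.sum_comp τ fun i : Fin d => ((i : ℝ) + 1) ^ 2).trans
      (Equiv.sum_comp σ fun i : Fin d => ((i : ℝ) + 1) ^ 2).symm).le
  refine ⟨hext, ?_⟩
  have hinj : Function.Injective
      fun (σ : Equiv.Perm (Fin d)) (i : Fin d) => ((σ i : ℕ) : ℝ) + 1 := by
    intro σ τ h
    ext i
    simpa using congrFun h i
  have hrange : {x : Fin d → ℝ | ∃ σ : Equiv.Perm (Fin d), x = fun i => ((σ i : ℕ) : ℝ) + 1} =
      Set.range fun (σ : Equiv.Perm (Fin d)) (i : Fin d) => ((σ i : ℕ) : ℝ) + 1 := by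
    ext x
    simp only [Set.mem_ofPred_eq, Set.mem_range, eq_comm]
  rw [hext, hrange, ← Nat.card_coe_set_eq, Nat.card_range_of_injective hinj,
    Nat.card_eq_fintype_card, Fintype.card_perm, Fintype.card_fin]
end

section
/- Let d ≥ 1. The Minkowski sum of the permutahedron Π_{d−1} = conv{(σ(1), …, σ(d)) : σ a permutation of {1,…,d}} and the nonpositive orthant (−∞,0]^d equals the polyhedron {x ∈ ℝ^d : for every subset S ⊆ {1,…,d}, Σ_{i∈S} x_i ≤ Σ_{i=1}^{|S|} (d − i + 1)}, i.e. the set of x with Σ_{i∈S} x_i ≤ d + (d−1) + ⋯ + (d − |S| + 1) for all S. In particular this polyhedron is described by a system of inequalities whose constraint matrix has all entries in {0,1}. -/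
open Pointwise

theorem sum_add_one_le_sum_range_sub (d : ℕ) (T : Finset ℕ) (hT : ∀ j ∈ T, j < d) :
    ∑ j ∈ T, ((j : ℝ) + 1) ≤ ∑ i ∈ Finset.range T.card, ((d : ℝ) - (i : ℝ)) := by
  revert hT
  refine Finset.induction_on_min T (by simp) fun a s ha ih hT => ?_
  have has : a ∉ s := fun h => lt_irrefl _ (ha a h)
  rw [Finset.sum_insert has, Finset.card_insert_of_notMem has, Finset.sum_range_succ]
  have hs := ih fun j hj => hT j (Finset.mem_insert_of_mem hj)
  have had := hT a (Finset.mem_insert_self a s)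
  have hsub : s ⊆ Finset.Ioo a d := fun j hj =>
    Finset.mem_Ioo.2 ⟨ha j hj, hT j (Finset.mem_insert_of_mem hj)⟩
  have hcard := Finset.card_le_card hsub
  rw [Nat.card_Ioo] at hcard
  have hle : a + 1 + s.card ≤ d := by omega
  have hle' : (a : ℝ) + 1 + s.card ≤ d := by exact_mod_cast hle
  linarith

theorem sum_Ici_add_one_eq_sum_range_sub (d : ℕ) (m : Fin d) :
    ∑ k ∈ Finset.Ici m, (((k : ℕ) : ℝ) + 1)
      = ∑ i ∈ Finset.range (d - m), ((d : ℝ) - (i : ℝ)) := by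
  refine Finset.sum_bij (fun k _ => d - 1 - (k : ℕ)) ?_ ?_ ?_ ?_
  · intro k hk
    have h : m ≤ k := Finset.mem_Ici.1 hk
    rw [Fin.le_def] at h
    have := k.isLt
    simp only [Finset.mem_range]
    omega
  · intro k _ l _ h
    have := k.isLt
    have := l.isLt
    ext
    omega
  · intro i hi
    rw [Finset.mem_range] at hi
    have := m.isLt
    refine ⟨⟨d - 1 - i, by omega⟩, Finset.mem_Ici.2 ?_, ?_⟩
    · rw [Fin.le_def]
      simp only
      omega
    · simp only
      omega
  · intro k _
    have h : (k : ℕ) + 1 + (d - 1 - k) = d := by omega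
    have h' : ((k : ℕ) : ℝ) + 1 + ((d - 1 - (k : ℕ) : ℕ) : ℝ) = d := by exact_mod_cast h
    linarith

/-- Abel summation: a nonnegative monotone sequence pairs nonpositively with a sequence all of
whose tail sums are nonpositive. -/
theorem sum_mul_nonpos_of_sum_Ici_nonpos {n : ℕ} (a y : Fin n → ℝ) (ha : Monotone a)
    (ha0 : ∀ i, 0 ≤ a i) (hy : ∀ m, ∑ k ∈ Finset.Ici m, y k ≤ 0) :
    ∑ k, a k * y k ≤ 0 := by
  induction n with
  | zero => simp
  | succ n ih =>
    have htail := ih (fun k => a k.succ - a 0) (fun k => y k.succ)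
      (fun i j hij => sub_le_sub_right (ha (Fin.succ_le_succ_iff.2 hij)) _)
      (fun i => sub_nonneg.2 (ha (Fin.zero_le _)))
      (fun m => by
        have h := hy m.succ
        rw [← Fin.map_succEmb_Ici, Finset.sum_map] at h
        exact h)
    have hall : ∑ k, y k ≤ 0 := by
      have h := hy 0
      rwa [show Finset.Ici (0 : Fin (n + 1)) = Finset.univ by ext; simp] at h
    have hsplit : ∑ k, a k * y k
        = a 0 * ∑ k, y k + ∑ k : Fin n, (a k.succ - a 0) * y k.succ := by
      simp only [Fin.sum_univ_succ, sub_mul, Finset.sum_sub_distrib, mul_add, Finset.mul_sum]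
      ring
    rw [hsplit]
    exact add_nonpos (mul_nonpos_of_nonneg_of_nonpos (ha0 0) hall) htail

/-- The greedy bound: on the polyhedron, a nonnegative linear functional is dominated by its value
at some vertex of the permutahedron. -/
theorem exists_perm_sum_mul_le {d : ℕ} (c x : Fin d → ℝ) (hc : ∀ i, 0 ≤ c i)
    (hx : ∀ S : Finset (Fin d),
      ∑ i ∈ S, x i ≤ ∑ i ∈ Finset.range S.card, ((d : ℝ) - (i : ℝ))) :
    ∃ σ : Equiv.Perm (Fin d), ∑ i, c i * x i ≤ ∑ i, c i * (((σ i : ℕ) : ℝ) + 1) := by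
  let τ := Tuple.sort c
  refine ⟨τ.symm, ?_⟩
  rw [← Equiv.sum_comp τ (fun i => c i * x i),
    ← Equiv.sum_comp τ (fun i => c i * (((τ.symm i : ℕ) : ℝ) + 1)), ← sub_nonpos,
    ← Finset.sum_sub_distrib]
  simp only [Equiv.symm_apply_apply, ← mul_sub]
  refine sum_mul_nonpos_of_sum_Ici_nonpos (fun k => c (τ k)) _ (Tuple.monotone_sort c)
    (fun k => hc _) fun m => ?_
  have h := hx ((Finset.Ici m).map τ.toEmbedding)
  rw [Finset.sum_map, Finset.card_map, Fin.card_Ici, ← sum_Ici_add_one_eq_sum_range_sub] at h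
  rw [Finset.sum_sub_distrib]
  exact sub_nonpos.2 h

/-- The Minkowski sum of the permutahedron `Π_{d-1}` and the nonpositive orthant equals
the polyhedron `{x : ∀ S ⊆ [d], ∑_{i ∈ S} x_i ≤ d + (d-1) + ⋯ + (d - |S| + 1)}`,
a system of inequalities with 0,1-constraint matrix. -/
theorem permutahedron_plus_nonpositive_orthant_eq_zero_one_polyhedron
    (d : ℕ) (hd : 1 ≤ d) :
    convexHull ℝ {x : Fin d → ℝ | ∃ σ : Equiv.Perm (Fin d),
        x = fun i => ((σ i : ℕ) : ℝ) + 1}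
      + {x : Fin d → ℝ | ∀ i, x i ≤ 0}
    = {x : Fin d → ℝ | ∀ S : Finset (Fin d),
        ∑ i ∈ S, x i ≤ ∑ i ∈ Finset.range S.card, ((d : ℝ) - (i : ℝ))} := by
  set V : Set (Fin d → ℝ) := {x | ∃ σ : Equiv.Perm (Fin d),
    x = fun i => ((σ i : ℕ) : ℝ) + 1}
  set N : Set (Fin d → ℝ) := {x | ∀ i, x i ≤ 0}
  have hNconv : Convex ℝ N := by
    rw [show N = Set.Iic 0 from rfl]
    exact convex_Iic 0
  have hNclosed : IsClosed N := by
    rw [show N = Set.Iic 0 from rfl]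
    exact isClosed_Iic
  have hVfin : V.Finite := by
    refine (Set.finite_range fun (σ : Equiv.Perm (Fin d)) (i : Fin d) =>
      ((σ i : ℕ) : ℝ) + 1).subset ?_
    rintro x ⟨σ, rfl⟩
    exact ⟨σ, rfl⟩
  apply Set.Subset.antisymm
  · rintro _ ⟨v, hv, w, hw, rfl⟩ S
    have hconv : Convex ℝ {x : Fin d → ℝ |
        ∑ i ∈ S, x i ≤ ∑ i ∈ Finset.range S.card, ((d : ℝ) - (i : ℝ))} := by
      refine convex_halfSpace_le ⟨fun x y => ?_, fun r x => ?_⟩ _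
      · simp [Finset.sum_add_distrib]
      · simp [Finset.mul_sum]
    have hvS : ∑ i ∈ S, v i ≤ ∑ i ∈ Finset.range S.card, ((d : ℝ) - (i : ℝ)) := by
      refine convexHull_min ?_ hconv hv
      rintro _ ⟨σ, rfl⟩
      have h := sum_add_one_le_sum_range_sub d
        (S.map (σ.toEmbedding.trans Fin.valEmbedding)) (by
          intro j hj
          obtain ⟨i, -, rfl⟩ := Finset.mem_map.1 hj
          exact (σ i).isLt)
      rw [Finset.sum_map, Finset.card_map] at h
      exact h
    have hwS : ∑ i ∈ S, w i ≤ 0 := Finset.sum_nonpos fun i _ => hw i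
    simp only [Pi.add_apply, Finset.sum_add_distrib]
    linarith
  · intro x hx
    by_contra hxmem
    have hclosed : IsClosed (convexHull ℝ V + N) :=
      hNclosed.add_left_of_isCompact (hVfin.isCompact_convexHull ℝ)
    obtain ⟨f, u, hfu, hux⟩ :=
      geometric_hahn_banach_closed_point ((convex_convexHull ℝ V).add hNconv) hclosed hxmem
    have hf : ∀ y : Fin d → ℝ, f y = ∑ i, f (Pi.single i 1) * y i := by
      intro y
      conv_lhs => rw [pi_eq_sum_univ' y]
      simp [map_sum, mul_comm]
    have hvertex : ∀ σ : Equiv.Perm (Fin d),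
        (fun i => ((σ i : ℕ) : ℝ) + 1) ∈ convexHull ℝ V := fun σ =>
      subset_convexHull ℝ V ⟨σ, rfl⟩
    have hnonneg : ∀ i, 0 ≤ f (Pi.single i 1) := by
      intro i
      by_contra! hneg
      set v : Fin d → ℝ := fun i => (((1 : Equiv.Perm (Fin d)) i : ℕ) : ℝ) + 1
      obtain ⟨n, hn⟩ := exists_nat_gt ((u - f v) / -f (Pi.single i 1))
      have hmem : (-(n : ℝ)) • (Pi.single i 1 : Fin d → ℝ) ∈ N := by
        intro j
        by_cases hij : j = i
        · subst hij
          simp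
        · simp [hij]
      have h := hfu _ (Set.add_mem_add (hvertex 1) hmem)
      rw [map_add, map_smul, smul_eq_mul] at h
      rw [div_lt_iff₀ (by linarith)] at hn
      linarith
    obtain ⟨σ, hσ⟩ := exists_perm_sum_mul_le _ x hnonneg hx
    have h := hfu _ (Set.add_mem_add (hvertex σ) (show (0 : Fin d → ℝ) ∈ N from fun _ => le_rfl))
    rw [add_zero, hf] at h
    rw [hf x] at hux
    linarith
end
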